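/- Let m > 1 and let A_1, A_2, …, A_m be n×n real matrices. Then A_1, …, A_m pairwise commute if and only if there exists a function f : ℝ^m → ℝ^{n×n} such that for all x = (x_1,…,x_m) and y = (y_1,…,y_m) in ℝ^m, f(x_1 + y_1, …, x_m + y_m) = exp(A_1 x_1 + ⋯ + A_m x_m) · exp(A_1 y_1 + ⋯ + A_m y_m). -/

import Mathlib

open Matrix NormedSpace

/-- An element commuting with the whole one-parameter group generated by `X` commutes
with `X`. -/
theorem commute_of_forall_commute_exp_smul {𝔸 : Type*} [NormedRing 𝔸] [NormedAlgebra ℝ 𝔸]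
    [NormedAlgebra ℚ 𝔸] [CompleteSpace 𝔸] {X B : 𝔸}
    (h : ∀ t : ℝ, Commute (exp (t • X)) B) : Commute X B := by
  have hX : HasDerivAt (fun t : ℝ => exp (t • X)) X 0 := by
    simpa using hasDerivAt_exp_smul_const (𝕂 := ℝ) X 0
  have hl := hX.mul_const B
  have hr := hX.const_mul B
  rw [show (fun t : ℝ => exp (t • X) * B) = fun t => B * exp (t • X) from
    funext fun t => (h t).eq] at hl
  exact hl.unique hr

open scoped Matrix.Norms.Operator in
theorem Matrix.commute_of_forall_commute_exp_smul_exp_smul {ι : Type*} [Fintype ι]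
    [DecidableEq ι] {X Y : Matrix ι ι ℝ}
    (h : ∀ s t : ℝ, Commute (exp (s • X)) (exp (t • Y))) : Commute X Y :=
  letI : NormedAlgebra ℚ (Matrix ι ι ℝ) := NormedAlgebra.restrictScalars ℚ ℝ _
  (commute_of_forall_commute_exp_smul fun t =>
    (commute_of_forall_commute_exp_smul fun s => h s t).symm).symm

/-- for `m > 1`, the matrices `A 1, …, A m` pairwise commute iff there exists
`f : ℝ^m → ℝ^{n×n}` with `f(x + y) = exp(∑ Aᵢxᵢ) * exp(∑ Aᵢyᵢ)` for all `x, y ∈ ℝ^m`. -/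
theorem pairwise_commute_iff_exists_fun_of_sum {n m : ℕ} (hm : 1 < m)
    (A : Fin m → Matrix (Fin n) (Fin n) ℝ) :
    (∀ i j, A i * A j = A j * A i) ↔
      ∃ f : (Fin m → ℝ) → Matrix (Fin n) (Fin n) ℝ,
        ∀ x y : Fin m → ℝ,
          f (x + y) = exp (∑ i, x i • A i) * exp (∑ i, y i • A i) := by
  constructor
  · intro h
    refine ⟨fun z => exp (∑ i, z i • A i), fun x y => ?_⟩
    have hc : Commute (∑ i, x i • A i) (∑ i, y i • A i) :=
      Commute.sum_left _ _ _ fun i _ => Commute.sum_right _ _ _ fun j _ =>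
        ((show Commute (A i) (A j) from h i j).smul_left _).smul_right _
    rw [← Matrix.exp_add_of_commute _ _ hc, ← Finset.sum_add_distrib]
    simp only [Pi.add_apply, add_smul]
  · rintro ⟨f, hf⟩ i j
    have hsingle (k : Fin m) (t : ℝ) :
        ∑ l, (Pi.single k t : Fin m → ℝ) l • A l = t • A k := by
      rw [Finset.sum_eq_single k (fun l _ hl => by simp [hl]) (by simp), Pi.single_eq_same]
    refine Matrix.commute_of_forall_commute_exp_smul_exp_smul fun s t => ?_
    have hst := hf (Pi.single i s) (Pi.single j t)
    have hts := hf (Pi.single j t) (Pi.single i s)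
    rw [hsingle, hsingle] at hst hts
    exact hst.symm.trans ((congrArg f (add_comm _ _)).trans hts)
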